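/- arXiv:2302.06585 — 3 statements merged into one kernel-verified Lean document; each statement's English description precedes it below -/
import Mathlib

section
/- Let n = 4 and let ω = diag(1,−1,−1,−1) be the Minkowski metric on ℝ⁴, with inverse entries ω^{ij}. There exist smooth compactly supported maps Ω, λ from ℝ⁴ to the symmetric real 4×4 matrices such that ∫_{ℝ⁴} Σ_{i,j,k,l} ω^{ik} ω^{jl} λ_{kl}(x) · Ricci(Ω)_{ij}(x) dx ≠ ∫_{ℝ⁴} Σ_{i,j,k,l} ω^{ik} ω^{jl} Ω_{kl}(x) · Ricci(λ)_{ij}(x) dx; that is, the linearized Ricci operator is not formally self-adjoint. -/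
open MeasureTheory

/-- Partial derivative in the `i`-th coordinate direction of `ℝⁿ = Fin n → ℝ`. -/
noncomputable def pd {n : ℕ} (i : Fin n) (f : (Fin n → ℝ) → ℝ) : (Fin n → ℝ) → ℝ :=
  fun x => fderiv ℝ f x (Pi.single i 1)

/-- Second partial derivative `∂_i ∂_j`. -/
noncomputable def pd2 {n : ℕ} (i j : Fin n) (f : (Fin n → ℝ) → ℝ) : (Fin n → ℝ) → ℝ :=
  pd i (pd j f)

/-- The Minkowski metric `diag(1,−1,−1,−1)` on `ℝ⁴`; it is its own inverse. -/
def minkowski : Matrix (Fin 4) (Fin 4) ℝ :=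
  fun i j => if i = j then (if i = 0 then 1 else -1) else 0

/-- The linearized Ricci operator over a constant metric with inverse entries `ωinv`:
`2·Ricci(Ω)_{ij} = Σ ω^{rs} ∂_r∂_s Ω_{ij} + ∂_i∂_j(tr_ω Ω) − Σ ω^{rs}(∂_r∂_i Ω_{sj} + ∂_r∂_j Ω_{si})`. -/
noncomputable def ricciOp {n : ℕ} (ωinv : Matrix (Fin n) (Fin n) ℝ)
    (Ω : (Fin n → ℝ) → Fin n → Fin n → ℝ) (i j : Fin n) : (Fin n → ℝ) → ℝ :=
  fun x =>
    (1 / 2) * ((∑ r, ∑ s, ωinv r s * pd2 r s (fun y => Ω y i j) x)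
      + pd2 i j (fun y => ∑ r, ∑ s, ωinv r s * Ω y r s) x
      - (∑ r, ∑ s, ωinv r s * (pd2 r i (fun y => Ω y s j) x + pd2 r j (fun y => Ω y s i) x)))

theorem contDiff_pd {n : ℕ} (i : Fin n) {f : (Fin n → ℝ) → ℝ}
    (hf : ContDiff ℝ (⊤ : ℕ∞) f) : ContDiff ℝ (⊤ : ℕ∞) (pd i f) :=
  (hf.fderiv_right (m := ((⊤ : ℕ∞) : WithTop ℕ∞)) (by simp)).clm_apply contDiff_const

theorem hasCompactSupport_pd {n : ℕ} (i : Fin n) {f : (Fin n → ℝ) → ℝ}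
    (hf : HasCompactSupport f) : HasCompactSupport (pd i f) :=
  hf.fderiv_apply ℝ (Pi.single i 1)

theorem pd_zero {n : ℕ} (i : Fin n) : pd i (fun _ : Fin n → ℝ => (0 : ℝ)) = fun _ => 0 := by
  funext x
  simp [pd]

theorem pd_neg {n : ℕ} (i : Fin n) (f : (Fin n → ℝ) → ℝ) :
    pd i (fun x => -f x) = fun x => -pd i f x := by
  funext x
  simp [pd, fderiv_fun_neg]

theorem pd2_zero {n : ℕ} (i j : Fin n) (x : Fin n → ℝ) :
    pd2 i j (fun _ : Fin n → ℝ => (0 : ℝ)) x = 0 := by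
  simp only [pd2, pd_zero]

theorem pd2_neg {n : ℕ} (i j : Fin n) (f : (Fin n → ℝ) → ℝ) (x : Fin n → ℝ) :
    pd2 i j (fun x => -f x) x = -pd2 i j f x := by
  simp only [pd2, pd_neg]

theorem pd_congr {n : ℕ} (i : Fin n) {f g : (Fin n → ℝ) → ℝ} {x : Fin n → ℝ}
    (h : f =ᶠ[nhds x] g) : pd i f =ᶠ[nhds x] pd i g := by
  filter_upwards [h.fderiv (𝕜 := ℝ)] with y hy
  simp [pd, hy]

theorem pd2_mul_coord {n : ℕ} {i j : Fin n} (hij : i ≠ j) (x : Fin n → ℝ) :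
    pd2 i j (fun y => y i * y j) x = 1 := by
  have hd : ∀ (k : Fin n) (y : Fin n → ℝ), HasFDerivAt (fun y : Fin n → ℝ => y k)
      (ContinuousLinearMap.proj (R := ℝ) (φ := fun _ : Fin n => ℝ) k) y :=
    fun k y => (ContinuousLinearMap.proj (R := ℝ) (φ := fun _ : Fin n => ℝ) k).hasFDerivAt
  have h : pd j (fun y : Fin n → ℝ => y i * y j) = fun y => y i := by
    funext y
    have hm := ((hd i y).fun_mul (hd j y)).fderiv
    simp [pd, hm, hij]
  simp [pd2, h, pd, (hd i x).fderiv]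

/-- There is a test function whose mixed second partial derivative is not identically zero. -/
theorem exists_testFunction_pd2_ne_zero {n : ℕ} {i j : Fin n} (hij : i ≠ j) :
    ∃ g : (Fin n → ℝ) → ℝ, ContDiff ℝ (⊤ : ℕ∞) g ∧ HasCompactSupport g ∧ pd2 i j g 0 ≠ 0 := by
  let b : ContDiffBump (0 : Fin n → ℝ) := ⟨1, 2, one_pos, one_lt_two⟩
  refine ⟨fun x => b x * (x i * x j), ?_, b.hasCompactSupport.mul_right, ?_⟩
  · exact b.contDiff.mul ((contDiff_apply ℝ ℝ i).mul (contDiff_apply ℝ ℝ j))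
  · have h : (fun x => b x * (x i * x j)) =ᶠ[nhds 0] fun x => x i * x j := by
      filter_upwards [b.eventuallyEq_one] with x hx
      simp [hx]
    have h2 := (pd_congr i (pd_congr j h)).eq_of_nhds
    change pd2 i j _ 0 = pd2 i j _ 0 at h2
    rw [h2, pd2_mul_coord hij]
    exact one_ne_zero

/-- The trace-free symmetric tensor field `f · (e₁ ⊗ e₂ + e₂ ⊗ e₁)`. -/
def offDiagTensor (f : (Fin 4 → ℝ) → ℝ) (x : Fin 4 → ℝ) (i j : Fin 4) : ℝ :=
  !![0, 0, 0, 0; 0, 0, f x, 0; 0, f x, 0, 0; 0, 0, 0, 0] i j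

/-- The symmetric tensor field `g · e₃ ⊗ e₃`. -/
def diagTensor (g : (Fin 4 → ℝ) → ℝ) (x : Fin 4 → ℝ) (i j : Fin 4) : ℝ :=
  !![0, 0, 0, 0; 0, 0, 0, 0; 0, 0, 0, 0; 0, 0, 0, g x] i j

theorem offDiagTensor_apply_eq (f : (Fin 4 → ℝ) → ℝ) (i j : Fin 4) :
    (fun x => offDiagTensor f x i j) = (fun _ => 0) ∨ (fun x => offDiagTensor f x i j) = f := by
  fin_cases i <;> fin_cases j <;> simp [offDiagTensor]

theorem diagTensor_apply_eq (g : (Fin 4 → ℝ) → ℝ) (i j : Fin 4) :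
    (fun x => diagTensor g x i j) = (fun _ => 0) ∨ (fun x => diagTensor g x i j) = g := by
  fin_cases i <;> fin_cases j <;> simp [diagTensor]

theorem minkowski_pairing (A B : Fin 4 → Fin 4 → ℝ) :
    ∑ i, ∑ j, ∑ k, ∑ l, minkowski i k * minkowski j l * A k l * B i j =
      ∑ i, ∑ j, minkowski i i * minkowski j j * A i j * B i j := by
  refine Finset.sum_congr rfl fun i _ => Finset.sum_congr rfl fun j _ => ?_
  rw [Finset.sum_eq_single i, Finset.sum_eq_single j]
  · intro l _ hl
    simp [minkowski, hl.symm]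
  · simp
  · intro k _ hk
    simp [minkowski, hk.symm]
  · simp

theorem ricciOp_offDiagTensor (f : (Fin 4 → ℝ) → ℝ) (x : Fin 4 → ℝ) :
    ricciOp minkowski (offDiagTensor f) 3 3 x = 0 := by
  simp [ricciOp, offDiagTensor, minkowski, Fin.sum_univ_four, pd2_zero]

theorem ricciOp_diagTensor (g : (Fin 4 → ℝ) → ℝ) (x : Fin 4 → ℝ) :
    ricciOp minkowski (diagTensor g) 1 2 x = -(1 / 2) * pd2 1 2 g x ∧
      ricciOp minkowski (diagTensor g) 2 1 x = -(1 / 2) * pd2 2 1 g x := by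
  constructor <;>
    simp [ricciOp, diagTensor, minkowski, Fin.sum_univ_four, pd2_zero, pd2_neg]

theorem pd2_comm {n : ℕ} (i j : Fin n) {f : (Fin n → ℝ) → ℝ}
    (hf : ContDiff ℝ (⊤ : ℕ∞) f) (x : Fin n → ℝ) : pd2 i j f x = pd2 j i f x := by
  have hd : DifferentiableAt ℝ (fderiv ℝ f) x :=
    ((hf.fderiv_right (m := ((⊤ : ℕ∞) : WithTop ℕ∞)) (by simp)).differentiable
      (by simp)).differentiableAt
  have key : ∀ k l : Fin n,
      pd2 k l f x = fderiv ℝ (fderiv ℝ f) x (Pi.single k 1) (Pi.single l 1) := by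
    intro k l
    have h := (hd.hasFDerivAt.clm_apply (hasFDerivAt_const (Pi.single l (1 : ℝ)) x)).fderiv
    simp only [pd2]
    unfold pd
    rw [h]
    simp
  rw [key, key]
  have h2 : ContDiff ℝ 2 f := hf.of_le (WithTop.coe_le_coe.mpr (le_top : (2 : ℕ∞) ≤ ⊤))
  exact (h2.contDiffAt.isSymmSndFDerivAt (by simp)) _ _

/-- The linearized Ricci operator over the Minkowski metric is *not* formally self-adjoint
with respect to the pairing `⟨A,B⟩_ω = Σ ω^{ik} ω^{jl} A_{ij} B_{kl}`. -/
theorem ricci_not_formally_self_adjoint :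
    ∃ (Ω lam : (Fin 4 → ℝ) → Fin 4 → Fin 4 → ℝ),
      (∀ i j, ContDiff ℝ (⊤ : ℕ∞) fun x => Ω x i j) ∧
      (∀ i j, HasCompactSupport fun x => Ω x i j) ∧
      (∀ x i j, Ω x i j = Ω x j i) ∧
      (∀ i j, ContDiff ℝ (⊤ : ℕ∞) fun x => lam x i j) ∧
      (∀ i j, HasCompactSupport fun x => lam x i j) ∧
      (∀ x i j, lam x i j = lam x j i) ∧
      (∫ x : Fin 4 → ℝ, ∑ i, ∑ j, ∑ k, ∑ l,
          minkowski i k * minkowski j l * lam x k l * ricciOp minkowski Ω i j x)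
        ≠ ∫ x : Fin 4 → ℝ, ∑ i, ∑ j, ∑ k, ∑ l,
            minkowski i k * minkowski j l * Ω x k l * ricciOp minkowski lam i j x := by
  obtain ⟨g, hg, hgc, hg0⟩ := exists_testFunction_pd2_ne_zero (n := 4) (i := 1) (j := 2) (by decide)
  have hf : ContDiff ℝ (⊤ : ℕ∞) (pd2 1 2 g) := contDiff_pd 1 (contDiff_pd 2 hg)
  have hfc : HasCompactSupport (pd2 1 2 g) := hasCompactSupport_pd 1 (hasCompactSupport_pd 2 hgc)
  refine ⟨offDiagTensor (pd2 1 2 g), diagTensor g, ?_, ?_, ?_, ?_, ?_, ?_, ?_⟩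
  · intro i j
    rcases offDiagTensor_apply_eq (pd2 1 2 g) i j with h | h <;> rw [h]
    · exact contDiff_const
    · exact hf
  · intro i j
    rcases offDiagTensor_apply_eq (pd2 1 2 g) i j with h | h <;> rw [h]
    · exact HasCompactSupport.zero
    · exact hfc
  · intro x i j
    fin_cases i <;> fin_cases j <;> rfl
  · intro i j
    rcases diagTensor_apply_eq g i j with h | h <;> rw [h]
    · exact contDiff_const
    · exact hg
  · intro i j
    rcases diagTensor_apply_eq g i j with h | h <;> rw [h]
    · exact HasCompactSupport.zero
    · exact hgc
  · intro x i j
    fin_cases i <;> fin_cases j <;> rfl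
  · have hL : ∀ x, ∑ i, ∑ j, minkowski i i * minkowski j j * diagTensor g x i j *
        ricciOp minkowski (offDiagTensor (pd2 1 2 g)) i j x = 0 := by
      intro x
      simp [Fin.sum_univ_four, diagTensor, ricciOp_offDiagTensor]
    have hR : ∀ x, ∑ i, ∑ j, minkowski i i * minkowski j j * offDiagTensor (pd2 1 2 g) x i j *
        ricciOp minkowski (diagTensor g) i j x = -(pd2 1 2 g x * pd2 1 2 g x) := by
      intro x
      simp [Fin.sum_univ_four, offDiagTensor, ricciOp_diagTensor, minkowski, pd2_comm 2 1 hg x]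
      ring
    simp only [minkowski_pairing, hL, hR, integral_zero, integral_neg]
    have hpos : 0 < ∫ x, pd2 1 2 g x * pd2 1 2 g x :=
      (hf.continuous.mul hf.continuous).integral_pos_of_hasCompactSupport_nonneg_nonzero
        hfc.mul_right (fun x => mul_self_nonneg _) (mul_self_ne_zero.mpr hg0)
    exact (neg_lt_zero.mpr hpos).ne'
end

section
/- (Minimal parametrization of the divergence operator.) Let η : ℝ³ → ℝ³ be a smooth vector field with ∂_1 η^1 + ∂_2 η^2 + ∂_3 η^3 = 0 on ℝ³. Then there exist smooth functions ξ^1, ξ^2 : ℝ³ → ℝ such that η^1 = −∂_3 ξ^2, η^2 = ∂_3 ξ^1, and η^3 = ∂_1 ξ^2 − ∂_2 ξ^1; that is, the div operator on ℝ³ admits a minimal parametrization using only two potentials (obtained from the curl parametrization by setting the third potential to zero). -/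
open MeasureTheory in
/-- Differentiation under the integral sign over a compact interval for a jointly `C¹` integrand. -/
theorem hasFDerivAt_intervalIntegral_of_contDiff {E F : Type*} [NormedAddCommGroup E]
    [NormedSpace ℝ E] [ProperSpace E] [NormedAddCommGroup F] [NormedSpace ℝ F]
    {f : E × ℝ → F} (hf : ContDiff ℝ 1 f) (a b : ℝ) (x₀ : E) :
    HasFDerivAt (fun x => ∫ t in a..b, f (x, t))
      (∫ t in a..b, (fderiv ℝ f (x₀, t)).comp (ContinuousLinearMap.inl ℝ E ℝ)) x₀ := by
  have hcont : Continuous fun p : E × ℝ =>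
      (fderiv ℝ f p).comp (ContinuousLinearMap.inl ℝ E ℝ) :=
    (hf.continuous_fderiv one_ne_zero).clm_comp continuous_const
  obtain ⟨C, hC⟩ := ((isCompact_closedBall x₀ 1).prod
    (isCompact_uIcc (a := a) (b := b))).exists_bound_of_continuousOn hcont.continuousOn
  refine intervalIntegral.hasFDerivAt_integral_of_dominated_of_fderiv_le
    (μ := volume) (𝕜 := ℝ) (F := fun x t => f (x, t)) (s := Metric.closedBall x₀ 1)
    (F' := fun x t => (fderiv ℝ f (x, t)).comp (ContinuousLinearMap.inl ℝ E ℝ))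
    (bound := fun _ => C) (Metric.closedBall_mem_nhds x₀ one_pos) ?_ ?_ ?_ ?_ ?_ ?_
  · exact .of_forall fun x =>
      (hf.continuous.comp (Continuous.prodMk_right x)).aestronglyMeasurable
  · exact (hf.continuous.comp (Continuous.prodMk_right x₀)).intervalIntegrable _ _
  · exact (hcont.comp (Continuous.prodMk_right x₀)).aestronglyMeasurable
  · exact .of_forall fun t ht x hx => hC (x, t) ⟨hx, Set.uIoc_subset_uIcc ht⟩
  · exact intervalIntegrable_const
  · exact .of_forall fun t _ x _ =>
      ((hf.differentiable one_ne_zero) (x, t)).hasFDerivAt.comp x (hasFDerivAt_prodMk_left x t)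

theorem fderiv_intervalIntegral_apply_of_contDiff {E F : Type*} [NormedAddCommGroup E]
    [NormedSpace ℝ E] [ProperSpace E] [NormedAddCommGroup F] [NormedSpace ℝ F] [CompleteSpace F]
    {f : E × ℝ → F} (hf : ContDiff ℝ 1 f) (a b : ℝ) (x v : E) :
    fderiv ℝ (fun x => ∫ t in a..b, f (x, t)) x v = ∫ t in a..b, fderiv ℝ f (x, t) (v, 0) := by
  have hcont : Continuous fun t : ℝ =>
      (fderiv ℝ f (x, t)).comp (ContinuousLinearMap.inl ℝ E ℝ) :=
    ((hf.continuous_fderiv one_ne_zero).comp (Continuous.prodMk_right x)).clm_comp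
      continuous_const
  rw [(hasFDerivAt_intervalIntegral_of_contDiff hf a b x).fderiv,
    ContinuousLinearMap.intervalIntegral_apply (hcont.intervalIntegrable a b)]
  rfl

/-- An interval integral depends smoothly on the parameters of a jointly smooth integrand. -/
theorem contDiff_intervalIntegral_of_contDiff {E F : Type*} [NormedAddCommGroup E]
    [NormedSpace ℝ E] [FiniteDimensional ℝ E] [NormedAddCommGroup F] [NormedSpace ℝ F]
    [CompleteSpace F] {f : E × ℝ → F} (hf : ContDiff ℝ (⊤ : ℕ∞) f) (a b : ℝ) :
    ContDiff ℝ (⊤ : ℕ∞) fun x => ∫ t in a..b, f (x, t) := by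
  have : ProperSpace E := FiniteDimensional.proper ℝ E
  refine contDiff_infty.2 fun n => ?_
  induction n generalizing f with
  | zero =>
    rw [Nat.cast_zero, contDiff_zero]
    exact intervalIntegral.continuous_parametric_intervalIntegral_of_continuous'
      (f := fun x t => f (x, t)) hf.continuous a b
  | succ n ih =>
    have hf1 : ContDiff ℝ 1 f := hf.of_le (by exact_mod_cast le_top)
    rw [Nat.cast_succ, contDiff_succ_iff_fderiv_apply]
    refine ⟨fun x => (hasFDerivAt_intervalIntegral_of_contDiff hf1 a b x).differentiableAt,
      by simp, fun v => ?_⟩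
    simp only [fderiv_intervalIntegral_apply_of_contDiff hf1]
    exact ih (f := fun p => fderiv ℝ f p (v, 0))
      ((contDiff_infty_iff_fderiv.1 hf).2.clm_apply contDiff_const)

/-- The primitive of `f` in the `i`-th variable which vanishes where `x i = 0`. -/
noncomputable def coordPrimitive {n : ℕ} (i : Fin n) (f : (Fin n → ℝ) → ℝ) :
    (Fin n → ℝ) → ℝ :=
  fun x => ∫ t in (0 : ℝ)..x i, f (Function.update x i t)

section

variable {n : ℕ} {f g : (Fin n → ℝ) → ℝ}

theorem ContDiff.function_update {E : Type*} [NormedAddCommGroup E] [NormedSpace ℝ E]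
    {m : WithTop ℕ∞} {u : E → Fin n → ℝ} {v : E → ℝ} (hu : ContDiff ℝ m u)
    (hv : ContDiff ℝ m v) (i : Fin n) :
    ContDiff ℝ m fun x => Function.update (u x) i (v x) := by
  refine contDiff_pi.2 fun j => ?_
  rcases eq_or_ne j i with rfl | h
  · simpa using hv
  · simpa [h] using contDiff_pi.1 hu j

theorem pd_hasDerivAt {x : Fin n → ℝ} (hf : DifferentiableAt ℝ f x) (i : Fin n) :
    HasDerivAt (fun t => f (Function.update x i t)) (pd i f x) (x i) := by
  have h := hasDerivAt_update x i (x i)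
  rw [← Function.update_eq_self i x] at hf
  simpa [pd, Function.comp_def] using hf.hasFDerivAt.comp_hasDerivAt (x i) h

theorem pd_sub {x : Fin n → ℝ} (hf : DifferentiableAt ℝ f x) (hg : DifferentiableAt ℝ g x)
    (i : Fin n) : pd i (fun y => f y - g y) x = pd i f x - pd i g x := by
  simp [pd, fderiv_fun_sub hf hg]

theorem ContDiff.pd (hf : ContDiff ℝ (⊤ : ℕ∞) f) (i : Fin n) :
    ContDiff ℝ (⊤ : ℕ∞) (_root_.pd i f) :=
  (contDiff_infty_iff_fderiv.1 hf).2.clm_apply contDiff_const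

theorem ContDiff.coordPrimitive (hf : ContDiff ℝ (⊤ : ℕ∞) f) (i : Fin n) :
    ContDiff ℝ (⊤ : ℕ∞) (coordPrimitive i f) := by
  have h : _root_.coordPrimitive i f = fun x =>
      x i * ∫ s in (0 : ℝ)..1, f (Function.update x i (s * x i)) := by
    funext x
    rw [intervalIntegral.mul_integral_comp_mul_right (f := fun t => f (Function.update x i t))]
    simp [_root_.coordPrimitive]
  rw [h]
  refine (contDiff_apply ℝ ℝ i).mul (contDiff_intervalIntegral_of_contDiff
    (f := fun p : (Fin n → ℝ) × ℝ => f (Function.update p.1 i (p.2 * p.1 i))) ?_ 0 1)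
  exact hf.comp (contDiff_fst.function_update
    (contDiff_snd.mul ((contDiff_apply ℝ ℝ i).comp contDiff_fst)) i)

theorem pd_coordPrimitive_self (hf : ContDiff ℝ (⊤ : ℕ∞) f) (i : Fin n) (x : Fin n → ℝ) :
    pd i (coordPrimitive i f) x = f x := by
  refine (pd_hasDerivAt ((hf.coordPrimitive i).differentiable (by simp) x) i).unique ?_
  have hc : Continuous fun t => f (Function.update x i t) :=
    hf.continuous.comp (continuous_const.update i continuous_id)
  simpa [coordPrimitive] using
    intervalIntegral.integral_hasDerivAt_right (hc.intervalIntegrable 0 (x i))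
      (hc.stronglyMeasurableAtFilter _ _) hc.continuousAt

theorem pd_coordPrimitive_of_ne (hf : ContDiff ℝ (⊤ : ℕ∞) f) {i j : Fin n} (hij : j ≠ i)
    (x : Fin n → ℝ) :
    pd j (coordPrimitive i f) x = coordPrimitive i (pd j f) x := by
  have hF : ContDiff ℝ 1 fun p : ℝ × ℝ =>
      f (Function.update (Function.update x j p.1) i p.2) :=
    (hf.comp ((contDiff_const.function_update contDiff_fst j).function_update
      contDiff_snd i)).of_le (by exact_mod_cast le_top)
  refine (pd_hasDerivAt ((hf.coordPrimitive i).differentiable (by simp) x) j).unique ?_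
  have h := (hasFDerivAt_intervalIntegral_of_contDiff hF 0 (x i) (x j)).differentiableAt
    |>.hasDerivAt
  rw [← fderiv_apply_one_eq_deriv, fderiv_intervalIntegral_apply_of_contDiff hF] at h
  convert h using 1
  · simp [coordPrimitive, hij.symm]
  · refine intervalIntegral.integral_congr fun t _ => ?_
    have h1 := pd_hasDerivAt (hf.differentiable (by simp) (Function.update x i t)) j
    have h2 := ((hF.differentiable one_ne_zero) (x j, t)).hasFDerivAt.comp_hasDerivAt (x j)
      ((hasDerivAt_id (x j)).prodMk (hasDerivAt_const (x j) t))
    rw [Function.update_of_ne hij] at h1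
    refine h1.unique ?_
    simpa only [Function.comp_def, id, Function.update_comm hij] using h2

theorem coordPrimitive_pd_self (hf : ContDiff ℝ (⊤ : ℕ∞) f) (i : Fin n) (x : Fin n → ℝ) :
    coordPrimitive i (pd i f) x = f x - f (Function.update x i 0) := by
  have hc : Continuous fun t => pd i f (Function.update x i t) :=
    (hf.pd i).continuous.comp (continuous_const.update i continuous_id)
  have h : ∀ t, HasDerivAt (fun t => f (Function.update x i t))
      (pd i f (Function.update x i t)) t := fun t => by
    simpa using pd_hasDerivAt (hf.differentiable (by simp) (Function.update x i t)) i
  simpa [coordPrimitive] using intervalIntegral.integral_eq_sub_of_hasDerivAt (fun t _ => h t)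
    (hc.intervalIntegrable 0 (x i))

theorem pd_comp_update (hf : ContDiff ℝ (⊤ : ℕ∞) f) (i : Fin n) (c : ℝ) (x : Fin n → ℝ) :
    pd i (fun y => f (Function.update y i c)) x = 0 := by
  have h : ContDiff ℝ (⊤ : ℕ∞) fun y => f (Function.update y i c) :=
    hf.comp (contDiff_id.function_update contDiff_const i)
  refine (pd_hasDerivAt (h.differentiable (by simp) x) i).unique ?_
  simpa using hasDerivAt_const (x i) (f (Function.update x i c))

theorem coordPrimitive_add (hf : Continuous f) (hg : Continuous g) (i : Fin n)
    (x : Fin n → ℝ) :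
    coordPrimitive i (fun y => f y + g y) x = coordPrimitive i f x + coordPrimitive i g x :=
  intervalIntegral.integral_add
    ((hf.comp (continuous_const.update i continuous_id)).intervalIntegrable _ _)
    ((hg.comp (continuous_const.update i continuous_id)).intervalIntegrable _ _)

end

/-- Minimal parametrization of the divergence operator on `ℝ³`: every smooth
divergence-free vector field `η` can be written with only two potentials as
`η¹ = −∂_3 ξ²`, `η² = ∂_3 ξ¹`, `η³ = ∂_1 ξ² − ∂_2 ξ¹`. -/
theorem div_minimal_parametrization
    (η : (Fin 3 → ℝ) → Fin 3 → ℝ)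
    (hsmooth : ∀ i, ContDiff ℝ (⊤ : ℕ∞) fun x => η x i)
    (hdiv : ∀ x, pd 0 (fun y => η y 0) x + pd 1 (fun y => η y 1) x
        + pd 2 (fun y => η y 2) x = 0) :
    ∃ ξ1 ξ2 : (Fin 3 → ℝ) → ℝ,
      ContDiff ℝ (⊤ : ℕ∞) ξ1 ∧ ContDiff ℝ (⊤ : ℕ∞) ξ2 ∧
      (∀ x, η x 0 = -pd 2 ξ2 x) ∧
      (∀ x, η x 1 = pd 2 ξ1 x) ∧
      (∀ x, η x 2 = pd 0 ξ2 x - pd 1 ξ1 x) := by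
  have hη₂ : ContDiff ℝ (⊤ : ℕ∞) fun y => η (Function.update y 2 0) 2 :=
    (hsmooth 2).comp (contDiff_id.function_update contDiff_const 2)
  have hA := hη₂.coordPrimitive 0
  have hB := (hsmooth 0).coordPrimitive 2
  have hpd : ∀ i x, pd i (fun y => coordPrimitive 0 (fun y => η (Function.update y 2 0) 2) y
      - coordPrimitive 2 (fun y => η y 0) y) x = _ := fun i x =>
    pd_sub (hA.differentiable (by simp) x) (hB.differentiable (by simp) x) i
  refine ⟨coordPrimitive 2 fun y => η y 1,
    fun x => coordPrimitive 0 (fun y => η (Function.update y 2 0) 2) x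
      - coordPrimitive 2 (fun y => η y 0) x, (hsmooth 1).coordPrimitive 2,
    hA.sub hB, fun x => ?_, fun x => ?_, fun x => ?_⟩
  · have h0 : pd 2 (fun y => η (Function.update y 2 0) 2) = fun _ => 0 :=
      funext fun y => pd_comp_update (hsmooth 2) 2 0 y
    rw [hpd, pd_coordPrimitive_self (hsmooth 0), pd_coordPrimitive_of_ne hη₂ (by decide), h0]
    simp [coordPrimitive]
  · rw [pd_coordPrimitive_self (hsmooth 1)]
  · have hsum := coordPrimitive_add ((hsmooth 0).pd 0).continuous
      ((hsmooth 1).pd 1).continuous 2 x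
    have hdiv' : (fun y => pd 0 (fun y => η y 0) y + pd 1 (fun y => η y 1) y)
        = fun y => -pd 2 (fun y => η y 2) y := funext fun y => by linarith [hdiv y]
    have hneg : coordPrimitive 2 (fun y => -pd 2 (fun y => η y 2) y) x
        = -coordPrimitive 2 (pd 2 fun y => η y 2) x := intervalIntegral.integral_neg
    rw [hdiv', hneg, coordPrimitive_pd_self (hsmooth 2)] at hsum
    rw [hpd, pd_coordPrimitive_self hη₂, pd_coordPrimitive_of_ne (hsmooth 0) (by decide),
      pd_coordPrimitive_of_ne (hsmooth 1) (by decide)]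
    linarith
end

section
/- For every natural number n ≥ 3, the real vector space W_n of all maps R : (Fin n)⁴ → ℝ satisfying the algebraic Riemann tensor symmetries R_{ijkl} = −R_{jikl}, R_{ijkl} = −R_{ijlk}, R_{ijkl} + R_{iklj} + R_{iljk} = 0, together with the trace-free (Weyl) condition Σ_{i=1}^{n} R_{ijil} = 0 for all j,l, has finite dimension dim_ℝ W_n = n(n+1)(n+2)(n−3)/12. In particular W_3 = 0, so the Weyl tensor vanishes identically in dimension 3. -/
/-- The space of algebraic Riemann tensors on `ℝⁿ`: maps `R : (Fin n)⁴ → ℝ` with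
`R_{ijkl} = −R_{jikl}`, `R_{ijkl} = −R_{ijlk}` and the first Bianchi identity
`R_{ijkl} + R_{iklj} + R_{iljk} = 0`. -/
def riemannSym (n : ℕ) : Submodule ℝ (Fin n → Fin n → Fin n → Fin n → ℝ) where
  carrier := {R | (∀ i j k l, R i j k l = - R j i k l) ∧
    (∀ i j k l, R i j k l = - R i j l k) ∧
    (∀ i j k l, R i j k l + R i k l j + R i l j k = 0)}
  zero_mem' := by
    refine ⟨?_, ?_, ?_⟩ <;> intro i j k l <;> simp
  add_mem' := by
    rintro a b ⟨ha1, ha2, ha3⟩ ⟨hb1, hb2, hb3⟩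
    refine ⟨?_, ?_, ?_⟩ <;> intro i j k l <;> simp only [Pi.add_apply]
    · linear_combination ha1 i j k l + hb1 i j k l
    · linear_combination ha2 i j k l + hb2 i j k l
    · linear_combination ha3 i j k l + hb3 i j k l
  smul_mem' := by
    rintro c a ⟨ha1, ha2, ha3⟩
    refine ⟨?_, ?_, ?_⟩ <;> intro i j k l <;>
      simp only [Pi.smul_apply, smul_eq_mul]
    · linear_combination c * ha1 i j k l
    · linear_combination c * ha2 i j k l
    · linear_combination c * ha3 i j k l

/-- The space of algebraic Weyl tensors: algebraic Riemann tensors which are moreover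
trace-free, `Σ_i R_{ijil} = 0` for all `j, l`. -/
def weylSym (n : ℕ) : Submodule ℝ (Fin n → Fin n → Fin n → Fin n → ℝ) :=
  (riemannSym n) ⊓
    { carrier := {R | ∀ j l, (∑ i, R i j i l) = 0}
      zero_mem' := by intro j l; simp
      add_mem' := by
        intro a b ha hb j l
        simp only [Pi.add_apply, Finset.sum_add_distrib]
        rw [ha j l, hb j l, add_zero]
      smul_mem' := by
        intro c a ha j l
        simp only [Pi.smul_apply, smul_eq_mul]
        rw [← Finset.mul_sum, ha j l, mul_zero] }

section TraceOfPi

variable {ι M : Type*} [Fintype ι] [DecidableEq ι] [AddCommGroup M] [Module ℝ M]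
  [Module.Free ℝ M] [Module.Finite ℝ M]

/-- The trace of an endomorphism of `ι → M` is the sum of the traces of its diagonal blocks. -/
theorem trace_pi_eq_sum (f : (ι → M) →ₗ[ℝ] (ι → M)) :
    LinearMap.trace ℝ (ι → M) f = ∑ i, LinearMap.trace ℝ M
      (LinearMap.proj i ∘ₗ f ∘ₗ LinearMap.single ℝ (fun _ => M) i) := by
  have h : f = ∑ i, (f ∘ₗ LinearMap.single ℝ (fun _ => M) i) ∘ₗ LinearMap.proj i := by
    refine LinearMap.ext fun x => ?_
    simp only [LinearMap.sum_apply, LinearMap.comp_apply, LinearMap.proj_apply,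
      LinearMap.single_apply, ← map_sum, Finset.univ_sum_single]
  conv_lhs => rw [h, map_sum]
  exact Finset.sum_congr rfl fun i _ => LinearMap.trace_comp_comm' _ _

end TraceOfPi

theorem trace_real (f : ℝ →ₗ[ℝ] ℝ) : LinearMap.trace ℝ ℝ f = f 1 := by
  rw [LinearMap.trace_eq_matrix_trace ℝ (Module.Basis.singleton Unit ℝ)]
  simp [Matrix.trace, LinearMap.toMatrix_apply]

theorem trace_matrix (n : ℕ) (f : (Fin n → Fin n → ℝ) →ₗ[ℝ] (Fin n → Fin n → ℝ)) :
    LinearMap.trace ℝ _ f = ∑ i, ∑ j,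
      f (fun a b => if a = i then if b = j then 1 else 0 else 0) i j := by
  simp only [trace_pi_eq_sum, trace_real]
  refine Finset.sum_congr rfl fun i _ => Finset.sum_congr rfl fun j _ => ?_
  simp only [LinearMap.comp_apply, LinearMap.proj_apply, LinearMap.single_apply]
  refine congrFun (congrFun (congrArg f ?_) i) j
  ext a b
  by_cases ha : a = i <;> by_cases hb : b = j <;> simp [ha, hb]

theorem trace_tensor (n : ℕ) (f : (Fin n → Fin n → Fin n → Fin n → ℝ) →ₗ[ℝ]
      (Fin n → Fin n → Fin n → Fin n → ℝ)) :
    LinearMap.trace ℝ _ f = ∑ i, ∑ j, ∑ k, ∑ l,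
      f (fun a b c d => if a = i then if b = j then if c = k then if d = l then 1 else 0
        else 0 else 0 else 0) i j k l := by
  simp only [trace_pi_eq_sum, trace_real]
  refine Finset.sum_congr rfl fun i _ => Finset.sum_congr rfl fun j _ =>
    Finset.sum_congr rfl fun k _ => Finset.sum_congr rfl fun l _ => ?_
  simp only [LinearMap.comp_apply, LinearMap.proj_apply, LinearMap.single_apply]
  refine congrFun (congrFun (congrFun (congrFun (congrArg f ?_) i) j) k) l
  ext a b c d
  by_cases ha : a = i <;> by_cases hb : b = j <;> by_cases hc : c = k <;> by_cases hd : d = l <;>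
    simp [ha, hb, hc, hd]

/-- Antisymmetrization in the first pair and in the last pair of indices, followed by
symmetrization under the exchange of the two pairs. -/
noncomputable def pairSymmetrize (n : ℕ) : (Fin n → Fin n → Fin n → Fin n → ℝ) →ₗ[ℝ]
    (Fin n → Fin n → Fin n → Fin n → ℝ) where
  toFun R i j k l := (R i j k l - R j i k l - R i j l k + R j i l k
    + R k l i j - R l k i j - R k l j i + R l k j i) / 8
  map_add' R S := by ext; simp only [Pi.add_apply]; ring
  map_smul' c R := by ext; simp only [Pi.smul_apply, smul_eq_mul, RingHom.id_apply]; ring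

/-- Removal of the cyclic part in the last three indices. -/
noncomputable def removeCyclic (n : ℕ) : (Fin n → Fin n → Fin n → Fin n → ℝ) →ₗ[ℝ]
    (Fin n → Fin n → Fin n → Fin n → ℝ) where
  toFun R i j k l := R i j k l - (R i j k l + R i k l j + R i l j k) / 3
  map_add' R S := by ext; simp only [Pi.add_apply]; ring
  map_smul' c R := by ext; simp only [Pi.smul_apply, smul_eq_mul, RingHom.id_apply]; ring

/-- The projection onto the algebraic Riemann tensors. -/
noncomputable def riemannProj (n : ℕ) : (Fin n → Fin n → Fin n → Fin n → ℝ) →ₗ[ℝ]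
    (Fin n → Fin n → Fin n → Fin n → ℝ) :=
  removeCyclic n ∘ₗ pairSymmetrize n

theorem riemannSym_pair_symm {n : ℕ} {R : Fin n → Fin n → Fin n → Fin n → ℝ}
    (hR : R ∈ riemannSym n) (i j k l : Fin n) : R i j k l = R k l i j := by
  obtain ⟨h1, h2, h3⟩ := hR
  linarith [h3 i j k l, h3 j k l i, h3 k l i j, h3 l i j k, h1 i j k l, h1 i k j l, h2 i k j l,
    h1 i l j k, h1 j k l i, h2 j l i k, h1 j l k i, h1 k l i j]

theorem riemannProj_isProj (n : ℕ) : LinearMap.IsProj (riemannSym n) (riemannProj n) where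
  map_mem R := by
    refine ⟨?_, ?_, ?_⟩ <;> intro i j k l <;>
      simp only [riemannProj, removeCyclic, pairSymmetrize, LinearMap.comp_apply,
        LinearMap.coe_mk, AddHom.coe_mk] <;> ring
  map_id R hR := by
    have h4 := riemannSym_pair_symm hR
    obtain ⟨h1, h2, h3⟩ := hR
    have hS : pairSymmetrize n R = R := by
      ext i j k l
      simp only [pairSymmetrize, LinearMap.coe_mk, AddHom.coe_mk]
      linarith [h4 i j k l, h4 j i k l, h4 i j l k, h4 j i l k, h1 i j k l, h2 i j k l, h2 j i k l]
    ext i j k l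
    simp only [riemannProj, LinearMap.comp_apply, hS]
    simp only [removeCyclic, LinearMap.coe_mk, AddHom.coe_mk, h3 i j k l]
    ring

theorem trace_riemannProj (n : ℕ) :
    LinearMap.trace ℝ _ (riemannProj n) = (n : ℝ) ^ 2 * (n ^ 2 - 1) / 12 := by
  rw [trace_tensor]
  simp only [riemannProj, removeCyclic, pairSymmetrize, LinearMap.comp_apply,
        LinearMap.coe_mk, AddHom.coe_mk]
  simp only [Finset.sum_add_distrib, Finset.sum_sub_distrib, ← Finset.sum_div]
  simp
  ring

/-- The Ricci contraction `R ↦ Σ_i R_{ijil}`. -/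
noncomputable def ricci (n : ℕ) : (Fin n → Fin n → Fin n → Fin n → ℝ) →ₗ[ℝ] (Fin n → Fin n → ℝ) where
  toFun R j l := ∑ i, R i j i l
  map_add' R S := by ext; simp [Finset.sum_add_distrib]
  map_smul' c R := by ext; simp [Finset.mul_sum]

/-- Symmetrization of a bilinear form. -/
noncomputable def symmetrize (n : ℕ) : (Fin n → Fin n → ℝ) →ₗ[ℝ] (Fin n → Fin n → ℝ) where
  toFun h i j := (h i j + h j i) / 2
  map_add' R S := by ext; simp only [Pi.add_apply]; ring
  map_smul' c R := by ext; simp only [Pi.smul_apply, smul_eq_mul, RingHom.id_apply]; ring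

theorem trace_symmetrize (n : ℕ) :
    LinearMap.trace ℝ _ (symmetrize n) = (n : ℝ) * (n + 1) / 2 := by
  rw [trace_matrix]
  simp only [symmetrize, LinearMap.coe_mk, AddHom.coe_mk]
  simp only [Finset.sum_add_distrib, ← Finset.sum_div]
  simp
  ring

/-- The Kulkarni–Nomizu product of a bilinear form with the Euclidean metric. -/
noncomputable def kulkarni (n : ℕ) : (Fin n → Fin n → ℝ) →ₗ[ℝ] (Fin n → Fin n → Fin n → Fin n → ℝ) where
  toFun h i j k l := h i k * (if j = l then 1 else 0) + h j l * (if i = k then 1 else 0)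
    - h i l * (if j = k then 1 else 0) - h j k * (if i = l then 1 else 0)
  map_add' R S := by ext; simp only [Pi.add_apply]; ring
  map_smul' c R := by ext; simp only [Pi.smul_apply, smul_eq_mul, RingHom.id_apply]; ring

/-- The (modified) Schouten tensor of a bilinear form regarded as a Ricci tensor. -/
noncomputable def schouten (n : ℕ) : (Fin n → Fin n → ℝ) →ₗ[ℝ] (Fin n → Fin n → ℝ) where
  toFun h i j := (h i j - (∑ a, h a a) / (2 * (n - 1)) * (if i = j then 1 else 0)) / (n - 2)
  map_add' R S := by ext; simp only [Pi.add_apply, Finset.sum_add_distrib]; ring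
  map_smul' c R := by
    ext; simp only [Pi.smul_apply, smul_eq_mul, RingHom.id_apply, ← Finset.mul_sum]; ring

/-- An algebraic Riemann tensor with prescribed Ricci contraction. -/
noncomputable def ricciLift (n : ℕ) :
    (Fin n → Fin n → ℝ) →ₗ[ℝ] (Fin n → Fin n → Fin n → Fin n → ℝ) :=
  kulkarni n ∘ₗ schouten n ∘ₗ symmetrize n

theorem ricciLift_mem (n : ℕ) (h : Fin n → Fin n → ℝ) : ricciLift n h ∈ riemannSym n := by
  set s := schouten n (symmetrize n h) with hs
  have hsymm : ∀ i j, s i j = s j i := by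
    intro i j
    simp only [hs, schouten, symmetrize, LinearMap.coe_mk, AddHom.coe_mk, eq_comm (a := j)]
    ring
  change kulkarni n s ∈ riemannSym n
  refine ⟨?_, ?_, ?_⟩ <;> intro i j k l <;>
    simp only [kulkarni, LinearMap.coe_mk, AddHom.coe_mk]
  · ring
  · ring
  · rw [hsymm k j, hsymm l j, hsymm l k]
    simp only [eq_comm (a := k) (b := j), eq_comm (a := l) (b := j), eq_comm (a := l) (b := k)]
    ring

theorem ricci_kulkarni (n : ℕ) (h : Fin n → Fin n → ℝ) (j l : Fin n) :
    ricci n (kulkarni n h) j l = (n - 2) * h j l + (∑ a, h a a) * (if j = l then 1 else 0) := by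
  simp only [ricci, kulkarni, LinearMap.coe_mk, AddHom.coe_mk, Finset.sum_add_distrib,
    Finset.sum_sub_distrib, ← Finset.sum_mul]
  simp
  ring

theorem ricci_kulkarni_schouten {n : ℕ} (hn : 3 ≤ n) (h : Fin n → Fin n → ℝ) :
    ricci n (kulkarni n (schouten n h)) = h := by
  have hn' : (3 : ℝ) ≤ n := by exact_mod_cast hn
  have h1 : (n : ℝ) - 1 ≠ 0 := by linarith
  have h2 : (n : ℝ) - 2 ≠ 0 := by linarith
  ext j l
  rw [ricci_kulkarni]
  simp only [schouten, LinearMap.coe_mk, AddHom.coe_mk, ← Finset.sum_div,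
    Finset.sum_sub_distrib, if_true, Finset.sum_const, Finset.card_univ, Fintype.card_fin,
    nsmul_eq_mul]
  field_simp
  ring

theorem symmetrize_ricci {n : ℕ} {R : Fin n → Fin n → Fin n → Fin n → ℝ}
    (hR : R ∈ riemannSym n) : symmetrize n (ricci n R) = ricci n R := by
  ext j l
  have h : ricci n R l j = ricci n R j l := by
    simp only [ricci, LinearMap.coe_mk, AddHom.coe_mk]
    exact Finset.sum_congr rfl fun i _ => riemannSym_pair_symm hR i l i j
  simp only [symmetrize, LinearMap.coe_mk, AddHom.coe_mk, h]
  ring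

theorem mem_weylSym {n : ℕ} {R : Fin n → Fin n → Fin n → Fin n → ℝ} :
    R ∈ weylSym n ↔ R ∈ riemannSym n ∧ ricci n R = 0 := by
  refine and_congr Iff.rfl ⟨fun h => ?_, fun h j l => congrFun (congrFun h j) l⟩
  ext j l
  exact h j l

/-- The projection of a tensor onto its Weyl part. -/
noncomputable def weylProj (n : ℕ) : (Fin n → Fin n → Fin n → Fin n → ℝ) →ₗ[ℝ]
    (Fin n → Fin n → Fin n → Fin n → ℝ) :=
  riemannProj n - ricciLift n ∘ₗ ricci n ∘ₗ riemannProj n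

theorem weylProj_isProj {n : ℕ} (hn : 3 ≤ n) : LinearMap.IsProj (weylSym n) (weylProj n) where
  map_mem R := by
    have hP := (riemannProj_isProj n).map_mem R
    refine mem_weylSym.2 ⟨sub_mem hP (ricciLift_mem n _), ?_⟩
    simp only [weylProj, ricciLift, LinearMap.sub_apply, LinearMap.comp_apply, map_sub,
      ricci_kulkarni_schouten hn, symmetrize_ricci hP, sub_self]
  map_id R hR := by
    obtain ⟨hV, hRic⟩ := mem_weylSym.1 hR
    simp only [weylProj, LinearMap.sub_apply, LinearMap.comp_apply,
      (riemannProj_isProj n).map_id R hV, hRic, map_zero, sub_zero]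

theorem trace_weylProj {n : ℕ} (hn : 3 ≤ n) :
    LinearMap.trace ℝ _ (weylProj n) = (n : ℝ) * (n + 1) * (n + 2) * (n - 3) / 12 := by
  have h : (ricci n ∘ₗ riemannProj n) ∘ₗ ricciLift n = symmetrize n := by
    refine LinearMap.ext fun h => ?_
    simp only [LinearMap.comp_apply, (riemannProj_isProj n).map_id _ (ricciLift_mem n h)]
    exact ricci_kulkarni_schouten hn _
  rw [weylProj, map_sub, LinearMap.trace_comp_comm', h, trace_riemannProj, trace_symmetrize]
  ring

theorem finrank_weylSym {n : ℕ} (hn : 3 ≤ n) :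
    Module.finrank ℝ (weylSym n) = n * (n + 1) * (n + 2) * (n - 3) / 12 := by
  have h := (weylProj_isProj hn).trace
  rw [trace_weylProj hn] at h
  have h' : n * (n + 1) * (n + 2) * (n - 3) = Module.finrank ℝ (weylSym n) * 12 := by
    rw [← Nat.cast_inj (R := ℝ)]
    push_cast [Nat.cast_sub hn]
    linarith
  rw [h', Nat.mul_div_cancel _ (by norm_num)]

/-- For `n ≥ 3`, the space of algebraic Weyl tensors in dimension `n` has dimension
`n(n+1)(n+2)(n−3)/12`; in particular it vanishes identically in dimension 3. -/
theorem weylSym_finrank (n : ℕ) (hn : 3 ≤ n) :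
    Module.finrank ℝ (weylSym n) = n * (n + 1) * (n + 2) * (n - 3) / 12 ∧
      ∀ R ∈ weylSym 3, R = 0 := by
  refine ⟨finrank_weylSym hn, fun R hR => ?_⟩
  have h : weylSym 3 = ⊥ := Submodule.finrank_eq_zero.1 (finrank_weylSym le_rfl)
  rwa [h, Submodule.mem_bot] at hR
end
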